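/- arXiv:2506.02923 — 12 statements merged into one kernel-verified Lean document; each statement's English description precedes it below -/
import Mathlib

section
/- Let (Ω, 𝒜, P) be a probability space, let Y, Y′ : Ω → ℝ be random variables with 0 ≤ Y ≤ 1 and 0 ≤ Y′ ≤ 1, let C, C′ take values in a measurable space in which the singleton {c} is measurable, and let Z take values in a measurable space in which the singleton {z} is measurable. Assume counterfactual consistency on {Z = z}: P-almost surely on the event {Z = z}, Y′ = Y and C′ = C. Then E[Y·1_{C = c}·1_{Z = z}] ≤ E[Y′·1_{C′ = c}] ≤ E[Y·1_{C = c}·1_{Z = z}] + 1 − P(Z = z). -/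
open MeasureTheory

/-- Indicator function of a set, real-valued. -/
noncomputable def ind {Ω : Type*} (s : Set Ω) (ω : Ω) : ℝ :=
  s.indicator (fun _ => (1 : ℝ)) ω

theorem stmt_0 {Ω : Type*} [MeasurableSpace Ω] (P : Measure Ω) [IsProbabilityMeasure P]
    {β γ : Type*} [MeasurableSpace β] [MeasurableSpace γ]
    (Y Y' : Ω → ℝ) (C C' : Ω → β) (Z : Ω → γ) (c : β) (z : γ)
    (hYm : Measurable Y) (hY'm : Measurable Y')
    (hCm : Measurable C) (hC'm : Measurable C') (hZm : Measurable Z)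
    (hc : MeasurableSet ({c} : Set β)) (hz : MeasurableSet ({z} : Set γ))
    (hY01 : ∀ ω, 0 ≤ Y ω ∧ Y ω ≤ 1) (hY'01 : ∀ ω, 0 ≤ Y' ω ∧ Y' ω ≤ 1)
    (hcons : ∀ᵐ ω ∂P, Z ω = z → Y' ω = Y ω ∧ C' ω = C ω) :
    (∫ ω, Y ω * ind {ω' | C ω' = c} ω * ind {ω' | Z ω' = z} ω ∂P
        ≤ ∫ ω, Y' ω * ind {ω' | C' ω' = c} ω ∂P) ∧
    (∫ ω, Y' ω * ind {ω' | C' ω' = c} ω ∂P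
        ≤ (∫ ω, Y ω * ind {ω' | C ω' = c} ω * ind {ω' | Z ω' = z} ω ∂P)
          + 1 - (P {ω | Z ω = z}).toReal) := by
  have mC : MeasurableSet {ω' | C ω' = c} := hCm hc
  have mC' : MeasurableSet {ω' | C' ω' = c} := hC'm hc
  have mZ : MeasurableSet {ω' | Z ω' = z} := hZm hz
  have im : ∀ s : Set Ω, MeasurableSet s → Measurable (ind s) := fun s hs =>
    measurable_const.indicator hs
  have i0 : ∀ (s : Set Ω) ω, 0 ≤ ind s ω ∧ ind s ω ≤ 1 := by
    intro s ω
    by_cases h : ω ∈ s <;> simp [ind, h]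
  have bd : ∀ f : Ω → ℝ, Measurable f → (∀ ω, 0 ≤ f ω ∧ f ω ≤ 1) → Integrable f P := by
    intro f hf h
    refine Integrable.of_bound hf.aestronglyMeasurable 1 (Filter.Eventually.of_forall fun ω => ?_)
    rw [Real.norm_eq_abs, abs_le]
    exact ⟨by linarith [(h ω).1], (h ω).2⟩
  have mul01 : ∀ a b : ℝ, (0 ≤ a ∧ a ≤ 1) → (0 ≤ b ∧ b ≤ 1) → (0 ≤ a * b ∧ a * b ≤ 1) :=
    fun a b ha hb => ⟨mul_nonneg ha.1 hb.1, mul_le_one₀ ha.2 hb.1 hb.2⟩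
  have h1 : Integrable (fun ω => Y ω * ind {ω' | C ω' = c} ω * ind {ω' | Z ω' = z} ω) P :=
    bd _ ((hYm.mul (im _ mC)).mul (im _ mZ))
      fun ω => mul01 _ _ (mul01 _ _ (hY01 ω) (i0 _ ω)) (i0 _ ω)
  have h2 : Integrable (fun ω => Y' ω * ind {ω' | C' ω' = c} ω) P :=
    bd _ (hY'm.mul (im _ mC')) fun ω => mul01 _ _ (hY'01 ω) (i0 _ ω)
  have h3 : Integrable (ind {ω' | Z ω' = z}) P := bd _ (im _ mZ) (i0 _)
  have e3 : ∫ ω, ind {ω' | Z ω' = z} ω ∂P = (P {ω | Z ω = z}).toReal := by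
    have := integral_indicator_one (μ := P) mZ
    exact this
  have h4 : Integrable (fun ω => 1 - ind {ω' | Z ω' = z} ω) P := (integrable_const 1).sub h3
  constructor
  · refine integral_mono_ae h1 h2 ?_
    filter_upwards [hcons] with ω hω
    by_cases h : Z ω = z
    · obtain ⟨a, b⟩ := hω h
      have b2 : C' ω = c ↔ C ω = c := by rw [b]
      by_cases hC : C ω = c <;> simp [ind, Set.indicator, h, a, b2, hC]
    · have := (mul01 _ _ (hY'01 ω) (i0 {ω' | C' ω' = c} ω)).1
      simpa [ind, Set.indicator, h] using this
  · have key : ∫ ω, Y' ω * ind {ω' | C' ω' = c} ω ∂P ≤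
        ∫ ω, (Y ω * ind {ω' | C ω' = c} ω * ind {ω' | Z ω' = z} ω
          + (1 - ind {ω' | Z ω' = z} ω)) ∂P := by
      refine integral_mono_ae h2 (h1.add ((integrable_const 1).sub h3)) ?_
      filter_upwards [hcons] with ω hω
      by_cases h : Z ω = z
      · obtain ⟨a, b⟩ := hω h
        have b2 : C' ω = c ↔ C ω = c := by rw [b]
        by_cases hC : C ω = c <;> simp [ind, Set.indicator, h, a, b2, hC]
      · have := (mul01 _ _ (hY'01 ω) (i0 {ω' | C' ω' = c} ω)).2
        simpa [ind, Set.indicator, h] using this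
    rw [integral_add h1 h4,
      integral_sub (integrable_const 1) h3, e3] at key
    simp only [integral_const, probReal_univ, smul_eq_mul, mul_one] at key
    linarith
end

section
/- Let (Ω, 𝒜, P) be a probability space, Y, Y′ : Ω → [0,1] random variables, C, C′ and Z random variables for which the events {C = c}, {C′ = c}, {Z = z} are measurable. Assume counterfactual consistency on {Z = z} (P-almost surely on {Z = z}, Y′ = Y and C′ = C) and assume P(C′ = c) > 0. Then E[Y′·1_{C′ = c}] / P(C′ = c) ≥ E[Y·1_{C = c}·1_{Z = z}] / ( P(C = c, Z = z) + 1 − P(Z = z) ), where the denominator on the right is strictly positive. -/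
open MeasureTheory

theorem stmt_2 {Ω : Type*} [MeasurableSpace Ω] (P : Measure Ω) [IsProbabilityMeasure P]
    {β γ : Type*} (Y Y' : Ω → ℝ) (C C' : Ω → β) (Z : Ω → γ) (c : β) (z : γ)
    (hYm : Measurable Y) (hY'm : Measurable Y')
    (hY01 : ∀ ω, 0 ≤ Y ω ∧ Y ω ≤ 1) (hY'01 : ∀ ω, 0 ≤ Y' ω ∧ Y' ω ≤ 1)
    (hC : MeasurableSet {ω | C ω = c}) (hC' : MeasurableSet {ω | C' ω = c})
    (hZ : MeasurableSet {ω | Z ω = z})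
    (hcons : ∀ᵐ ω ∂P, Z ω = z → Y' ω = Y ω ∧ C' ω = C ω)
    (hpos : 0 < (P {ω | C' ω = c}).toReal) :
    (∫ ω, Y' ω * ind {ω' | C' ω' = c} ω ∂P) / (P {ω | C' ω = c}).toReal
      ≥ (∫ ω, Y ω * ind {ω' | C ω' = c} ω * ind {ω' | Z ω' = z} ω ∂P)
          / ((P {ω | C ω = c ∧ Z ω = z}).toReal + 1 - (P {ω | Z ω = z}).toReal) ∧
    0 < (P {ω | C ω = c ∧ Z ω = z}).toReal + 1 - (P {ω | Z ω = z}).toReal := by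
  have hp : (P {ω | C' ω = c}).toReal ≤
      (P {ω | C ω = c ∧ Z ω = z}).toReal + 1 - (P {ω | Z ω = z}).toReal := by
    have h1 : P.real {ω | C' ω = c} ≤ P.real ({ω | C ω = c ∧ Z ω = z} ∪ {ω | Z ω = z}ᶜ) := by
      refine ENNReal.toReal_mono (measure_ne_top _ _) (measure_mono_ae ?_)
      filter_upwards [hcons] with ω h hc
      by_cases hz : Z ω = z
      · exact Or.inl ⟨(h hz).2 ▸ hc, hz⟩
      · exact Or.inr hz
    have h2 := measureReal_union_le (μ := P) {ω | C ω = c ∧ Z ω = z} {ω | Z ω = z}ᶜ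
    have h3 := probReal_compl_eq_one_sub (μ := P) hZ
    simp only [Measure.real] at h1 h2 h3
    linarith
  have hi : ∀ (s : Set Ω) ω, 0 ≤ ind s ω ∧ ind s ω ≤ 1 := by
    intro s ω
    by_cases h : ω ∈ s <;> simp [ind, h]
  have him : ∀ (s : Set Ω), MeasurableSet s → Measurable (ind s) := by
    intro s hs
    exact measurable_const.indicator hs
  have hB : Integrable (fun ω => Y' ω * ind {ω' | C' ω' = c} ω) P := by
    refine Integrable.of_bound (hY'm.mul (him _ hC')).aestronglyMeasurable 1 ?_
    refine Filter.Eventually.of_forall fun ω => ?_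
    have a := hY'01 ω
    have b := hi {ω' | C' ω' = c} ω
    rw [Real.norm_eq_abs, abs_of_nonneg (mul_nonneg a.1 b.1)]
    exact mul_le_one₀ a.2 b.1 b.2
  have hA0 : ∀ ω, 0 ≤ Y ω * ind {ω' | C ω' = c} ω * ind {ω' | Z ω' = z} ω := fun ω =>
    mul_nonneg (mul_nonneg (hY01 ω).1 (hi _ ω).1) (hi _ ω).1
  have hAB : (∫ ω, Y ω * ind {ω' | C ω' = c} ω * ind {ω' | Z ω' = z} ω ∂P) ≤
      ∫ ω, Y' ω * ind {ω' | C' ω' = c} ω ∂P := by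
    refine integral_mono_of_nonneg (Filter.Eventually.of_forall hA0) hB ?_
    filter_upwards [hcons] with ω h
    by_cases hz : Z ω = z
    · obtain ⟨h1, h2⟩ := h hz
      by_cases hc : C ω = c
      · have hc' : C' ω = c := h2.trans hc
        simp [ind, hz, h1, hc, hc']
      · have hc' : ¬ C' ω = c := fun h => hc (h2.symm.trans h)
        simp [ind, hc, hc']
    · have := mul_nonneg (hY'01 ω).1 (hi {ω' | C' ω' = c} ω).1
      have e : ind {ω' | Z ω' = z} ω = 0 := by simp [ind, hz]
      simpa [e] using this
  refine ⟨?_, hpos.trans_le hp⟩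
  exact div_le_div₀ ((integral_nonneg hA0).trans hAB) hAB hpos hp
end

section
/- Let (Ω, 𝒜, P) be a probability space, Y, Y′ : Ω → [0,1] random variables, C, C′ and Z random variables for which the events {C = c}, {C′ = c}, {Z = z} are measurable. Assume counterfactual consistency on {Z = z} (P-almost surely on {Z = z}, Y′ = Y and C′ = C) and assume P(C′ = c) > 0. Then E[Y′·1_{C′ = c}] / P(C′ = c) ≤ ( E[Y·1_{C = c}·1_{Z = z}] + 1 − P(Z = z) ) / ( P(C = c, Z = z) + 1 − P(Z = z) ). -/
open MeasureTheory

theorem stmt_3 {Ω : Type*} [MeasurableSpace Ω] (P : Measure Ω) [IsProbabilityMeasure P]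
    {β γ : Type*} (Y Y' : Ω → ℝ) (C C' : Ω → β) (Z : Ω → γ) (c : β) (z : γ)
    (hYm : Measurable Y) (hY'm : Measurable Y')
    (hY01 : ∀ ω, 0 ≤ Y ω ∧ Y ω ≤ 1) (hY'01 : ∀ ω, 0 ≤ Y' ω ∧ Y' ω ≤ 1)
    (hC : MeasurableSet {ω | C ω = c}) (hC' : MeasurableSet {ω | C' ω = c})
    (hZ : MeasurableSet {ω | Z ω = z})
    (hcons : ∀ᵐ ω ∂P, Z ω = z → Y' ω = Y ω ∧ C' ω = C ω)
    (hpos : 0 < (P {ω | C' ω = c}).toReal) :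
    (∫ ω, Y' ω * ind {ω' | C' ω' = c} ω ∂P) / (P {ω | C' ω = c}).toReal
      ≤ ((∫ ω, Y ω * ind {ω' | C ω' = c} ω * ind {ω' | Z ω' = z} ω ∂P)
            + 1 - (P {ω | Z ω = z}).toReal)
          / ((P {ω | C ω = c ∧ Z ω = z}).toReal + 1 - (P {ω | Z ω = z}).toReal) := by
  have hi : ∀ (s : Set Ω) (ω : Ω), 0 ≤ ind s ω ∧ ind s ω ≤ 1 := by
    intro s ω
    by_cases h : ω ∈ s <;> simp [ind, h]
  have him : ∀ s : Set Ω, MeasurableSet s → Measurable (ind s) := fun s hs =>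
    measurable_const.indicator hs
  have hint : ∀ s : Set Ω, MeasurableSet s → ∫ ω, ind s ω ∂P = (P s).toReal := by
    intro s hs
    exact integral_indicator_one hs
  have hI : ∀ f : Ω → ℝ, Measurable f → (∀ ω, 0 ≤ f ω ∧ f ω ≤ 1) → Integrable f P := by
    intro f hf h
    refine Integrable.of_bound hf.aestronglyMeasurable 1 (Filter.Eventually.of_forall fun ω => ?_)
    rw [Real.norm_eq_abs, abs_of_nonneg (h ω).1]
    exact (h ω).2
  have hCZ : MeasurableSet {ω | C ω = c ∧ Z ω = z} := hC.inter hZ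
  have mul01 : ∀ a b : ℝ, (0 ≤ a ∧ a ≤ 1) → (0 ≤ b ∧ b ≤ 1) → 0 ≤ a * b ∧ a * b ≤ 1 :=
    fun a b ha hb => ⟨mul_nonneg ha.1 hb.1, mul_le_one₀ ha.2 hb.1 hb.2⟩
  have iN : Integrable (fun ω => Y' ω * ind {ω' | C' ω' = c} ω) P :=
    hI _ (hY'm.mul (him _ hC')) fun ω => mul01 _ _ (hY'01 ω) (hi _ ω)
  have iA : Integrable (fun ω => Y ω * ind {ω' | C ω' = c} ω * ind {ω' | Z ω' = z} ω) P :=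
    hI _ ((hYm.mul (him _ hC)).mul (him _ hZ)) fun ω =>
      mul01 _ _ (mul01 _ _ (hY01 ω) (hi _ ω)) (hi _ ω)
  have iD := hI _ (him _ hC') (hi _)
  have iZ := hI _ (him _ hZ) (hi _)
  have ip := hI _ (him _ hCZ) (hi _)
  have h2 : (∫ ω, Y ω * ind {ω' | C ω' = c} ω * ind {ω' | Z ω' = z} ω ∂P)
      ≤ ∫ ω, ind {ω | C ω = c ∧ Z ω = z} ω ∂P := by
    refine integral_mono iA ip fun ω => ?_
    by_cases h1 : C ω = c <;> by_cases h2 : Z ω = z <;> simp [ind, h1, h2, (hY01 ω).2]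
  have h1 : (∫ ω, (Y' ω * ind {ω' | C' ω' = c} ω + ind {ω | C ω = c ∧ Z ω = z} ω) ∂P)
      ≤ ∫ ω, (Y ω * ind {ω' | C ω' = c} ω * ind {ω' | Z ω' = z} ω + ind {ω | C' ω = c} ω) ∂P := by
    refine integral_mono_ae (iN.add ip) (iA.add iD) ?_
    filter_upwards [hcons] with ω hω
    by_cases h2 : Z ω = z
    · obtain ⟨e1, e2⟩ := hω h2
      by_cases h1 : C ω = c <;> simp [ind, h1, h2, e1, e2]
    · by_cases h3 : C' ω = c <;> simp [ind, h2, h3, (hY'01 ω).2]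
  have h3 : (∫ ω, (ind {ω | C' ω = c} ω + ind {ω | Z ω = z} ω) ∂P)
      ≤ ∫ ω, (ind {ω | C ω = c ∧ Z ω = z} ω + 1) ∂P := by
    refine integral_mono_ae (iD.add iZ) (ip.add (integrable_const 1)) ?_
    filter_upwards [hcons] with ω hω
    by_cases h2 : Z ω = z
    · obtain ⟨e1, e2⟩ := hω h2
      by_cases h1 : C ω = c <;> simp [ind, h1, h2, e2]
    · by_cases h3 : C' ω = c <;> simp [ind, h2, h3]
  rw [integral_add iN ip, integral_add iA iD, hint _ hC', hint _ hCZ] at h1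
  rw [integral_add iD iZ, integral_add ip (integrable_const 1), hint _ hC', hint _ hCZ,
    hint _ hZ] at h3
  rw [hint _ hCZ] at h2
  simp only [integral_const, probReal_univ, smul_eq_mul, mul_one] at h3
  have hp : 0 ≤ (P {ω | C ω = c ∧ Z ω = z}).toReal := ENNReal.toReal_nonneg
  generalize (∫ ω, Y' ω * ind {ω' | C' ω' = c} ω ∂P) = N at *
  generalize (∫ ω, Y ω * ind {ω' | C ω' = c} ω * ind {ω' | Z ω' = z} ω ∂P) = A at *
  generalize (P {ω | C ω = c ∧ Z ω = z}).toReal = p at *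
  generalize (P {ω | C' ω = c}).toReal = D at *
  generalize (P {ω | Z ω = z}).toReal = q at *
  have hd : 0 < p + 1 - q := by linarith
  rw [div_le_div_iff₀ hpos hd]
  nlinarith [mul_nonneg (sub_nonneg.2 h2) (by linarith : (0:ℝ) ≤ p + 1 - q - D),
    mul_le_mul_of_nonneg_right h1 hd.le]
end

section
/- Let (Ω, 𝒜, P) be a probability space. For each label e ∈ {1, 2} (two candidate decisions d and d*), let Y_e, Y′_e : Ω → [0,1] and C_e, C′_e, Z_e be random variables for which the events {C_e = c}, {C′_e = c}, {Z_e = z} are measurable, satisfying counterfactual consistency on {Z_e = z}: P-almost surely on {Z_e = z}, Y′_e = Y_e and C′_e = C_e; assume P(C′_1 = c) > 0 and P(C′_2 = c) > 0. If E[Y_1·1_{C_1 = c}·1_{Z_1 = z}] / ( P(C_1 = c, Z_1 = z) + 1 − P(Z_1 = z) ) − ( E[Y_2·1_{C_2 = c}·1_{Z_2 = z}] + 1 − P(Z_2 = z) ) / ( P(C_2 = c, Z_2 = z) + 1 − P(Z_2 = z) ) > 0, then E[Y′_1·1_{C′_1 = c}] / P(C′_1 = c) > E[Y′_2·1_{C′_2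 = c}] / P(C′_2 = c). -/
open MeasureTheory

lemma aux_int {Ω : Type*} [MeasurableSpace Ω] (P : Measure Ω) [IsProbabilityMeasure P]
    {f : Ω → ℝ} (hm : Measurable f) (h : ∀ ω, 0 ≤ f ω ∧ f ω ≤ 1) : Integrable f P := by
  refine Integrable.of_bound hm.aestronglyMeasurable 1 (Filter.Eventually.of_forall fun ω => ?_)
  rw [Real.norm_eq_abs, abs_of_nonneg (h ω).1]
  exact (h ω).2

lemma ind_meas {Ω : Type*} [MeasurableSpace Ω] {s : Set Ω} (hs : MeasurableSet s) :
    Measurable (ind s) := measurable_const.indicator hs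

lemma ind_01 {Ω : Type*} (s : Set Ω) (ω : Ω) : 0 ≤ ind s ω ∧ ind s ω ≤ 1 := by
  by_cases h : ω ∈ s <;> simp [ind, h]

lemma ind_integral {Ω : Type*} [MeasurableSpace Ω] (P : Measure Ω) {s : Set Ω}
    (hs : MeasurableSet s) : ∫ ω, ind s ω ∂P = (P s).toReal := by
  have := integral_indicator_one (μ := P) hs
  exact this

lemma aux_main {Ω : Type*} [MeasurableSpace Ω] (P : Measure Ω) [IsProbabilityMeasure P]
    {β γ : Type*} (Y Y' : Ω → ℝ) (C C' : Ω → β) (Z : Ω → γ) (c : β) (z : γ)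
    (hYm : Measurable Y) (hYm' : Measurable Y')
    (hY : ∀ ω, 0 ≤ Y ω ∧ Y ω ≤ 1) (hY' : ∀ ω, 0 ≤ Y' ω ∧ Y' ω ≤ 1)
    (hC : MeasurableSet {ω | C ω = c}) (hC' : MeasurableSet {ω | C' ω = c})
    (hZ : MeasurableSet {ω | Z ω = z})
    (hcons : ∀ᵐ ω ∂P, Z ω = z → Y' ω = Y ω ∧ C' ω = C ω)
    (hpos : 0 < (P {ω | C' ω = c}).toReal) :
    (∫ ω, Y ω * ind {ω' | C ω' = c} ω * ind {ω' | Z ω' = z} ω ∂P)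
          / ((P {ω | C ω = c ∧ Z ω = z}).toReal + 1 - (P {ω | Z ω = z}).toReal)
      ≤ (∫ ω, Y' ω * ind {ω' | C' ω' = c} ω ∂P) / (P {ω | C' ω = c}).toReal ∧
    (∫ ω, Y' ω * ind {ω' | C' ω' = c} ω ∂P) / (P {ω | C' ω = c}).toReal ≤
      ((∫ ω, Y ω * ind {ω' | C ω' = c} ω * ind {ω' | Z ω' = z} ω ∂P)
              + 1 - (P {ω | Z ω = z}).toReal)
            / ((P {ω | C ω = c ∧ Z ω = z}).toReal + 1 - (P {ω | Z ω = z}).toReal) := by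
  have hCZ : MeasurableSet {ω | C ω = c ∧ Z ω = z} := hC.inter hZ
  have b01 : ∀ {a b : ℝ}, (0 ≤ a ∧ a ≤ 1) → (0 ≤ b ∧ b ≤ 1) → 0 ≤ a * b ∧ a * b ≤ 1 :=
    fun ha hb => ⟨mul_nonneg ha.1 hb.1, mul_le_one₀ ha.2 hb.1 hb.2⟩
  have iA : Integrable (fun ω => Y ω * ind {ω' | C ω' = c} ω * ind {ω' | Z ω' = z} ω) P :=
    aux_int P ((hYm.mul (ind_meas hC)).mul (ind_meas hZ))
      fun ω => b01 (b01 (hY ω) (ind_01 _ ω)) (ind_01 _ ω)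
  have iB : Integrable (fun ω => Y' ω * ind {ω' | C' ω' = c} ω) P :=
    aux_int P (hYm'.mul (ind_meas hC')) fun ω => b01 (hY' ω) (ind_01 _ ω)
  have iD : Integrable (fun ω => ind {ω' | C' ω' = c} ω) P := aux_int P (ind_meas hC') (ind_01 _)
  have iZ : Integrable (fun ω => ind {ω' | Z ω' = z} ω) P := aux_int P (ind_meas hZ) (ind_01 _)
  have ip : Integrable (fun ω => ind {ω | C ω = c ∧ Z ω = z} ω) P :=
    aux_int P (ind_meas hCZ) (ind_01 _)
  have h0 : 0 ≤ ∫ ω, Y ω * ind {ω' | C ω' = c} ω * ind {ω' | Z ω' = z} ω ∂P :=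
    integral_nonneg fun ω => (b01 (b01 (hY ω) (ind_01 _ ω)) (ind_01 _ ω)).1
  have h1 := integral_mono_ae (μ := P) iA iB (by
    filter_upwards [hcons] with ω h
    have := hY ω
    have := hY' ω
    by_cases hz : Z ω = z
    · obtain ⟨h1, h2⟩ := h hz
      by_cases h3 : C ω = c <;> simp [ind, Set.indicator, hz, h1, h2, h3]
    · by_cases h3 : C' ω = c <;> simp [ind, Set.indicator, hz, h3, this])
  have h2 := integral_mono_ae (μ := P) (iB.add ip) (iD.add iA) (by
    filter_upwards [hcons] with ω h
    have := hY ω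
    have := hY' ω
    by_cases hz : Z ω = z
    · obtain ⟨h1, h2⟩ := h hz
      by_cases h3 : C ω = c <;> simp [ind, Set.indicator, hz, h1, h2, h3, add_comm]
    · by_cases h3 : C' ω = c <;> simp [ind, Set.indicator, hz, h3, this])
  have h3 := integral_mono_ae (μ := P) (iD.add iZ) (ip.add (integrable_const (1:ℝ))) (by
    filter_upwards [hcons] with ω h
    by_cases hz : Z ω = z
    · obtain ⟨h1, h2⟩ := h hz
      by_cases h3 : C ω = c <;> simp [ind, Set.indicator, hz, h2, h3]
    · by_cases h3 : C' ω = c <;> simp [ind, Set.indicator, hz, h3])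
  have h4 := integral_mono_ae (μ := P) iA ip (by
    filter_upwards with ω
    have := hY ω
    by_cases hz : Z ω = z <;> by_cases h3 : C ω = c <;> simp [ind, Set.indicator, hz, h3, this])
  have h5 := integral_mono_ae (μ := P) iZ (integrable_const (1:ℝ))
    (Filter.Eventually.of_forall fun ω => (ind_01 _ ω).2)
  rw [integral_add' iB ip, integral_add' iD iA, ind_integral P hC', ind_integral P hCZ] at h2
  rw [integral_add' iD iZ, integral_add' ip (integrable_const _), ind_integral P hC',
    ind_integral P hCZ, ind_integral P hZ] at h3
  rw [ind_integral P hCZ] at h4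
  rw [ind_integral P hZ] at h5
  simp only [integral_const, probReal_univ, smul_eq_mul, mul_one] at h3 h5
  generalize (∫ ω, Y ω * ind {ω' | C ω' = c} ω * ind {ω' | Z ω' = z} ω ∂P) = A at *
  generalize (∫ ω, Y' ω * ind {ω' | C' ω' = c} ω ∂P) = B at *
  generalize (P {ω | C' ω = c}).toReal = D at *
  generalize (P {ω | C ω = c ∧ Z ω = z}).toReal = p at *
  generalize (P {ω | Z ω = z}).toReal = q at *
  have hp : 0 < p + 1 - q := by linarith
  constructor
  · rw [div_le_div_iff₀ hp hpos]
    nlinarith [mul_nonneg h0 (show 0 ≤ p + 1 - q - D by linarith),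
      mul_nonneg (sub_nonneg.2 h1) hp.le]
  · rw [div_le_div_iff₀ hpos hp]
    nlinarith [mul_nonneg (show 0 ≤ p - A by linarith) (show 0 ≤ p + 1 - q - D by linarith),
      mul_nonneg (show 0 ≤ D + A - B - p by linarith) hp.le]

theorem stmt_4 {Ω : Type*} [MeasurableSpace Ω] (P : Measure Ω) [IsProbabilityMeasure P]
    {β γ : Type*}
    (Y₁ Y₁' Y₂ Y₂' : Ω → ℝ) (C₁ C₁' C₂ C₂' : Ω → β) (Z₁ Z₂ : Ω → γ) (c : β) (z : γ)
    (hY₁m : Measurable Y₁) (hY₁'m : Measurable Y₁')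
    (hY₂m : Measurable Y₂) (hY₂'m : Measurable Y₂')
    (hY₁01 : ∀ ω, 0 ≤ Y₁ ω ∧ Y₁ ω ≤ 1) (hY₁'01 : ∀ ω, 0 ≤ Y₁' ω ∧ Y₁' ω ≤ 1)
    (hY₂01 : ∀ ω, 0 ≤ Y₂ ω ∧ Y₂ ω ≤ 1) (hY₂'01 : ∀ ω, 0 ≤ Y₂' ω ∧ Y₂' ω ≤ 1)
    (hC₁ : MeasurableSet {ω | C₁ ω = c}) (hC₁' : MeasurableSet {ω | C₁' ω = c})
    (hC₂ : MeasurableSet {ω | C₂ ω = c}) (hC₂' : MeasurableSet {ω | C₂' ω = c})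
    (hZ₁ : MeasurableSet {ω | Z₁ ω = z}) (hZ₂ : MeasurableSet {ω | Z₂ ω = z})
    (hcons₁ : ∀ᵐ ω ∂P, Z₁ ω = z → Y₁' ω = Y₁ ω ∧ C₁' ω = C₁ ω)
    (hcons₂ : ∀ᵐ ω ∂P, Z₂ ω = z → Y₂' ω = Y₂ ω ∧ C₂' ω = C₂ ω)
    (hpos₁ : 0 < (P {ω | C₁' ω = c}).toReal)
    (hpos₂ : 0 < (P {ω | C₂' ω = c}).toReal)
    (hgap :
      (∫ ω, Y₁ ω * ind {ω' | C₁ ω' = c} ω * ind {ω' | Z₁ ω' = z} ω ∂P)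
          / ((P {ω | C₁ ω = c ∧ Z₁ ω = z}).toReal + 1 - (P {ω | Z₁ ω = z}).toReal)
        - ((∫ ω, Y₂ ω * ind {ω' | C₂ ω' = c} ω * ind {ω' | Z₂ ω' = z} ω ∂P)
              + 1 - (P {ω | Z₂ ω = z}).toReal)
            / ((P {ω | C₂ ω = c ∧ Z₂ ω = z}).toReal + 1 - (P {ω | Z₂ ω = z}).toReal)
        > 0) :
    (∫ ω, Y₁' ω * ind {ω' | C₁' ω' = c} ω ∂P) / (P {ω | C₁' ω = c}).toReal
      > (∫ ω, Y₂' ω * ind {ω' | C₂' ω' = c} ω ∂P) / (P {ω | C₂' ω = c}).toReal := by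
  have e1 := (aux_main P Y₁ Y₁' C₁ C₁' Z₁ c z hY₁m hY₁'m hY₁01 hY₁'01 hC₁ hC₁' hZ₁ hcons₁ hpos₁).1
  have e2 := (aux_main P Y₂ Y₂' C₂ C₂' Z₂ c z hY₂m hY₂'m hY₂01 hY₂'01 hC₂ hC₂' hZ₂ hcons₂ hpos₂).2
  linarith
end

section
/- Let (Ω, 𝒜, P) be a probability space and λ > 0. For each label e ∈ {1, 2}, let Y_e, Y′_e : Ω → [0,1] and C_e, C′_e, Z_e be random variables for which the events {C_e = c}, {C′_e = c}, {Z_e = z} are measurable, satisfying counterfactual consistency on {Z_e = z}: P-almost surely on {Z_e = z}, Y′_e = Y_e and C′_e = C_e; assume P(C′_1 = c) > 0 and P(C′_2 = c) > 0. If E[Y_1·1_{C_1 = c}·1_{Z_1 = z}] / ( P(C_1 = c, Z_1 = z) + 1 − P(Z_1 = z) ) − ( E[Y_2·1_{C_2 = c}·1_{Z_2 = z}] + 1 − P(Z_2 = z) ) / ( P(C_2 = c, Z_2 = z) + 1 − P(Z_2 = z) ) > λ, then E[Y′_1·1_{C′_1 = c}] / P(C′_1 = c) − E[Y′_2·1_{C′_2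 = c}] / P(C′_2 = c) > λ. -/
open MeasureTheory

theorem aux_bounds {Ω : Type*} [MeasurableSpace Ω] (P : Measure Ω) [IsProbabilityMeasure P]
    {β γ : Type*} (Y Y' : Ω → ℝ) (C C' : Ω → β) (Z : Ω → γ) (c : β) (z : γ)
    (hYm : Measurable Y) (hY'm : Measurable Y')
    (hY01 : ∀ ω, 0 ≤ Y ω ∧ Y ω ≤ 1) (hY'01 : ∀ ω, 0 ≤ Y' ω ∧ Y' ω ≤ 1)
    (hC : MeasurableSet {ω | C ω = c}) (hC' : MeasurableSet {ω | C' ω = c})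
    (hZ : MeasurableSet {ω | Z ω = z})
    (hcons : ∀ᵐ ω ∂P, Z ω = z → Y' ω = Y ω ∧ C' ω = C ω)
    (hpos : 0 < (P {ω | C' ω = c}).toReal) :
    (∫ ω, Y ω * ind {ω' | C ω' = c} ω * ind {ω' | Z ω' = z} ω ∂P)
          / ((P {ω | C ω = c ∧ Z ω = z}).toReal + 1 - (P {ω | Z ω = z}).toReal)
      ≤ (∫ ω, Y' ω * ind {ω' | C' ω' = c} ω ∂P) / (P {ω | C' ω = c}).toReal ∧
    (∫ ω, Y' ω * ind {ω' | C' ω' = c} ω ∂P) / (P {ω | C' ω = c}).toReal ≤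
      ((∫ ω, Y ω * ind {ω' | C ω' = c} ω * ind {ω' | Z ω' = z} ω ∂P)
              + 1 - (P {ω | Z ω = z}).toReal)
            / ((P {ω | C ω = c ∧ Z ω = z}).toReal + 1 - (P {ω | Z ω = z}).toReal) := by
  classical
  have hind : ∀ s : Set Ω, MeasurableSet s →
      Integrable (ind s) P ∧ ∫ ω, ind s ω ∂P = (P s).toReal := by
    intro s hs
    refine ⟨(integrable_const (1 : ℝ)).indicator hs, ?_⟩
    exact integral_indicator_one hs
  have hmind : ∀ s : Set Ω, MeasurableSet s → Measurable (ind s) :=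
    fun s hs => measurable_const.indicator hs
  have hval : ∀ (s : Set Ω) ω, ind s ω = if ω ∈ s then 1 else 0 := by
    intro s ω
    simp [ind, Set.indicator_apply]
  have hCZ : MeasurableSet {ω | C ω = c ∧ Z ω = z} := hC.inter hZ
  obtain ⟨iCZ, eCZ⟩ := hind _ hCZ
  obtain ⟨iC', eC'⟩ := hind _ hC'
  obtain ⟨iZ, eZ⟩ := hind _ hZ
  have iN' : Integrable (fun ω => Y' ω * ind {ω' | C' ω' = c} ω) P := by
    refine Integrable.of_bound (hY'm.mul (hmind _ hC')).aestronglyMeasurable 1 (ae_of_all _ ?_)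
    intro ω
    have := hY'01 ω
    rw [hval, Real.norm_eq_abs, abs_le]
    split_ifs <;> constructor <;> linarith
  have iN : Integrable (fun ω => Y ω * ind {ω' | C ω' = c} ω * ind {ω' | Z ω' = z} ω) P := by
    refine Integrable.of_bound
      ((hYm.mul (hmind _ hC)).mul (hmind _ hZ)).aestronglyMeasurable 1 (ae_of_all _ ?_)
    intro ω
    have := hY01 ω
    rw [hval, hval, Real.norm_eq_abs, abs_le]
    split_ifs <;> constructor <;> linarith
  have h0 : 0 ≤ ∫ ω, Y ω * ind {ω' | C ω' = c} ω * ind {ω' | Z ω' = z} ω ∂P := by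
    refine integral_nonneg ?_
    intro ω
    have := hY01 ω
    simp only [hval, Pi.zero_apply]
    split_ifs <;> linarith
  have h1 := integral_mono_ae iN iN' (by
    filter_upwards [hcons] with ω h
    have := hY01 ω
    have := hY'01 ω
    simp only [hval, Set.mem_setOf_eq]
    by_cases hz : Z ω = z
    · obtain ⟨a, b⟩ := h hz
      simp [a, b, hz]
    · simp only [hz, if_false]
      split_ifs <;> linarith)
  have h2 := integral_mono_ae iN iCZ (ae_of_all _ (by
    intro ω
    have := hY01 ω
    simp only [hval, Set.mem_setOf_eq]
    by_cases hz : Z ω = z <;> by_cases hc : C ω = c <;> simp [hz, hc] <;> linarith))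
  have h3 := integral_mono_ae (iN'.add iCZ) (iN.add iC') (by
    filter_upwards [hcons] with ω h
    have := hY01 ω
    have := hY'01 ω
    simp only [hval, Set.mem_setOf_eq, Pi.add_apply]
    by_cases hz : Z ω = z
    · obtain ⟨a, b⟩ := h hz
      simp [a, b, hz]
    · simp only [hz, if_false, and_false]
      split_ifs <;> linarith)
  have h4 := integral_mono_ae (iC'.add iZ) (iCZ.add (integrable_const (1 : ℝ))) (by
    filter_upwards [hcons] with ω h
    simp only [hval, Set.mem_setOf_eq, Pi.add_apply]
    by_cases hz : Z ω = z
    · obtain ⟨a, b⟩ := h hz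
      simp [b, hz]
    · simp only [hz, if_false, and_false]
      split_ifs <;> linarith)
  rw [integral_add' iN' iCZ, integral_add' iN iC'] at h3
  rw [integral_add' iC' iZ, integral_add' iCZ (integrable_const (1 : ℝ))] at h4
  simp only [integral_const, probReal_univ, smul_eq_mul, mul_one] at h4
  rw [eCZ] at h2 h3 h4
  rw [eC'] at h3 h4
  rw [eZ] at h4
  set N := ∫ ω, Y ω * ind {ω' | C ω' = c} ω * ind {ω' | Z ω' = z} ω ∂P
  set N' := ∫ ω, Y' ω * ind {ω' | C' ω' = c} ω ∂P
  generalize (P {ω | C' ω = c}).toReal = p' at *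
  generalize (P {ω | C ω = c ∧ Z ω = z}).toReal = p at *
  generalize (P {ω | Z ω = z}).toReal = r at *
  have hd : 0 < p + 1 - r := by linarith
  constructor
  · exact div_le_div₀ (by linarith) h1 hpos (by linarith)
  · have e1 : N' / p' ≤ 1 - (p - N) / p' := by
      rw [div_le_iff₀ hpos, sub_mul, div_mul_cancel₀ _ hpos.ne']
      linarith
    have e2 : (N + 1 - r) / (p + 1 - r) = 1 - (p - N) / (p + 1 - r) := by
      field_simp
      ring
    have e3 : (p - N) / (p + 1 - r) ≤ (p - N) / p' :=
      div_le_div_of_nonneg_left (by linarith) hpos (by linarith)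
    rw [e2]
    linarith

theorem stmt_5 {Ω : Type*} [MeasurableSpace Ω] (P : Measure Ω) [IsProbabilityMeasure P]
    {β γ : Type*} (lam : ℝ) (hlam : 0 < lam)
    (Y₁ Y₁' Y₂ Y₂' : Ω → ℝ) (C₁ C₁' C₂ C₂' : Ω → β) (Z₁ Z₂ : Ω → γ) (c : β) (z : γ)
    (hY₁m : Measurable Y₁) (hY₁'m : Measurable Y₁')
    (hY₂m : Measurable Y₂) (hY₂'m : Measurable Y₂')
    (hY₁01 : ∀ ω, 0 ≤ Y₁ ω ∧ Y₁ ω ≤ 1) (hY₁'01 : ∀ ω, 0 ≤ Y₁' ω ∧ Y₁' ω ≤ 1)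
    (hY₂01 : ∀ ω, 0 ≤ Y₂ ω ∧ Y₂ ω ≤ 1) (hY₂'01 : ∀ ω, 0 ≤ Y₂' ω ∧ Y₂' ω ≤ 1)
    (hC₁ : MeasurableSet {ω | C₁ ω = c}) (hC₁' : MeasurableSet {ω | C₁' ω = c})
    (hC₂ : MeasurableSet {ω | C₂ ω = c}) (hC₂' : MeasurableSet {ω | C₂' ω = c})
    (hZ₁ : MeasurableSet {ω | Z₁ ω = z}) (hZ₂ : MeasurableSet {ω | Z₂ ω = z})
    (hcons₁ : ∀ᵐ ω ∂P, Z₁ ω = z → Y₁' ω = Y₁ ω ∧ C₁' ω = C₁ ω)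
    (hcons₂ : ∀ᵐ ω ∂P, Z₂ ω = z → Y₂' ω = Y₂ ω ∧ C₂' ω = C₂ ω)
    (hpos₁ : 0 < (P {ω | C₁' ω = c}).toReal)
    (hpos₂ : 0 < (P {ω | C₂' ω = c}).toReal)
    (hgap :
      (∫ ω, Y₁ ω * ind {ω' | C₁ ω' = c} ω * ind {ω' | Z₁ ω' = z} ω ∂P)
          / ((P {ω | C₁ ω = c ∧ Z₁ ω = z}).toReal + 1 - (P {ω | Z₁ ω = z}).toReal)
        - ((∫ ω, Y₂ ω * ind {ω' | C₂ ω' = c} ω * ind {ω' | Z₂ ω' = z} ω ∂P)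
              + 1 - (P {ω | Z₂ ω = z}).toReal)
            / ((P {ω | C₂ ω = c ∧ Z₂ ω = z}).toReal + 1 - (P {ω | Z₂ ω = z}).toReal)
        > lam) :
    (∫ ω, Y₁' ω * ind {ω' | C₁' ω' = c} ω ∂P) / (P {ω | C₁' ω = c}).toReal
      - (∫ ω, Y₂' ω * ind {ω' | C₂' ω' = c} ω ∂P) / (P {ω | C₂' ω = c}).toReal
      > lam := by
  have a := (aux_bounds P Y₁ Y₁' C₁ C₁' Z₁ c z hY₁m hY₁'m hY₁01 hY₁'01 hC₁ hC₁' hZ₁ hcons₁ hpos₁).1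
  have b := (aux_bounds P Y₂ Y₂' C₂ C₂' Z₂ c z hY₂m hY₂'m hY₂01 hY₂'01 hC₂ hC₂' hZ₂ hcons₂ hpos₂).2
  linarith
end

section
/- Let (Ω, 𝒜, P) be a probability space. For each label e ∈ {1, 2} (two decisions observed in experimental regimes do(r_i) and do(r_j) respectively), let Y_e, Y′_e : Ω → [0,1] and C_e, C′_e, S_e be random variables, with values s_1 (for e = 1) and s_2 (for e = 2) such that the events {C_e = c}, {C′_e = c}, {S_e = s_e} are measurable, satisfying counterfactual consistency on {S_e = s_e}: P-almost surely on {S_e = s_e}, Y′_e = Y_e and C′_e = C_e; assume P(C′_1 = c) > 0 and P(C′_2 = c) > 0. If E[Y_1·1_{C_1 = c}·1_{S_1 = s_1}] / ( P(C_1 = c, S_1 = s_1) + 1 − P(S_1 = s_1) ) − ( E[Y_2·1_{C_2 = c}·1_{S_2 = s_2}] + 1 − P(S_2 = s_2) ) / ( P(C_2 = c, S_2 = s_2) + 1 − P(S_2 = s_2) ) > 0, then E[Y′_1·1_{C′_1 = c}] / P(C′_1 = c) > E[Y′_2·1_{C′_2 = c}] / P(C′_2 = c). -/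
open MeasureTheory

theorem aux_ind {Ω : Type*} [MeasurableSpace Ω] (P : Measure Ω) [IsProbabilityMeasure P]
    {β γ : Type*} (Y Y' : Ω → ℝ) (C C' : Ω → β) (S : Ω → γ) (c : β) (s : γ)
    (hYm : Measurable Y) (hY'm : Measurable Y')
    (hY : ∀ ω, 0 ≤ Y ω ∧ Y ω ≤ 1) (hY' : ∀ ω, 0 ≤ Y' ω ∧ Y' ω ≤ 1)
    (hC : MeasurableSet {ω | C ω = c}) (hC' : MeasurableSet {ω | C' ω = c})
    (hS : MeasurableSet {ω | S ω = s})
    (hcons : ∀ᵐ ω ∂P, S ω = s → Y' ω = Y ω ∧ C' ω = C ω) (A B q N D : ℝ)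
    (hA : A = ∫ ω, Y ω * ind {ω' | C ω' = c} ω * ind {ω' | S ω' = s} ω ∂P)
    (hB : B = (P {ω | C ω = c ∧ S ω = s}).toReal)
    (hq : q = (P {ω | S ω = s}).toReal)
    (hN : N = ∫ ω, Y' ω * ind {ω' | C' ω' = c} ω ∂P)
    (hD : D = (P {ω | C' ω = c}).toReal) :
    0 ≤ A ∧ A ≤ B ∧ A ≤ N ∧ B ≤ D ∧ D ≤ B + 1 - q ∧ N + B ≤ A + D := by
  have hI : ∀ T : Set Ω, MeasurableSet T → Measurable (ind T) := fun T hT =>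
    measurable_const.indicator hT
  have hP : ∀ T : Set Ω, MeasurableSet T → (P T).toReal = ∫ ω, ind T ω ∂P := by
    intro T hT
    have := integral_indicator_one (μ := P) hT
    exact this.symm
  have hb : ∀ f : Ω → ℝ, Measurable f → (∀ ω, 0 ≤ f ω ∧ f ω ≤ 1) → Integrable f P := by
    intro f hf h
    refine Integrable.of_bound hf.aestronglyMeasurable 1 (Filter.Eventually.of_forall fun ω => ?_)
    rw [Real.norm_eq_abs, abs_of_nonneg (h ω).1]; exact (h ω).2
  have hCS : MeasurableSet {ω | C ω = c ∧ S ω = s} := hC.inter hS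
  have h01 : ∀ (T : Set Ω) ω, 0 ≤ ind T ω ∧ ind T ω ≤ 1 := by
    intro T ω
    by_cases h : ω ∈ T <;> simp [ind, h]
  have iA : Integrable (fun ω => Y ω * ind {ω' | C ω' = c} ω * ind {ω' | S ω' = s} ω) P := by
    refine hb _ ((hYm.mul (hI _ hC)).mul (hI _ hS)) fun ω => ?_
    have h1 := h01 {ω' | C ω' = c} ω
    have h2 := h01 {ω' | S ω' = s} ω
    have h3 := hY ω
    exact ⟨mul_nonneg (mul_nonneg h3.1 h1.1) h2.1,
      mul_le_one₀ (mul_le_one₀ h3.2 h1.1 h1.2) h2.1 h2.2⟩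
  have iN : Integrable (fun ω => Y' ω * ind {ω' | C' ω' = c} ω) P := by
    refine hb _ (hY'm.mul (hI _ hC')) fun ω => ?_
    have h1 := h01 {ω' | C' ω' = c} ω
    have h3 := hY' ω
    exact ⟨mul_nonneg h3.1 h1.1, mul_le_one₀ h3.2 h1.1 h1.2⟩
  have iB := hb _ (hI _ hCS) (h01 _)
  have iq := hb _ (hI _ hS) (h01 _)
  have iD := hb _ (hI _ hC') (h01 _)
  have h1 : (1:ℝ) = ∫ _ω, (1:ℝ) ∂P := by simp
  rw [hP _ hCS] at hB
  rw [hP _ hS] at hq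
  rw [hP _ hC'] at hD
  refine ⟨?_, ?_, ?_, ?_, ?_, ?_⟩
  · rw [hA]
    exact integral_nonneg fun ω =>
      mul_nonneg (mul_nonneg (hY ω).1 (h01 _ ω).1) (h01 _ ω).1
  · rw [hA, hB]
    refine integral_mono_ae iA iB (Filter.Eventually.of_forall fun ω => ?_)
    have := hY ω
    by_cases a : C ω = c <;> by_cases b : S ω = s <;> simp [ind, a, b, this]
  · rw [hA, hN]
    refine integral_mono_ae iA iN ?_
    filter_upwards [hcons] with ω h
    have := hY ω
    have := hY' ω
    by_cases b : S ω = s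
    · obtain ⟨e1, e2⟩ := h b
      by_cases a : C ω = c <;> simp [ind, a, b, e1, e2]
    · by_cases a : C' ω = c <;> simp [ind, a, b, this]
  · rw [hB, hD]
    refine integral_mono_ae iB iD ?_
    filter_upwards [hcons] with ω h
    by_cases b : S ω = s
    · obtain ⟨e1, e2⟩ := h b
      by_cases a : C ω = c <;> simp [ind, a, b, e2]
    · by_cases a : C' ω = c <;> simp [ind, a, b]
  · suffices D + q ≤ B + 1 by linarith
    rw [hB, hD, hq, h1, ← integral_add iD iq, ← integral_add iB (integrable_const _)]
    refine integral_mono_ae (iD.add iq) (iB.add (integrable_const _)) ?_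
    filter_upwards [hcons] with ω h
    by_cases b : S ω = s
    · obtain ⟨e1, e2⟩ := h b
      by_cases a : C ω = c <;> simp [ind, a, b, e2]
    · by_cases a : C' ω = c <;> simp [ind, a, b]
  · rw [hB, hD, hN, hA, ← integral_add iN iB, ← integral_add iA iD]
    refine integral_mono_ae (iN.add iB) (iA.add iD) ?_
    filter_upwards [hcons] with ω h
    have := hY' ω
    by_cases b : S ω = s
    · obtain ⟨e1, e2⟩ := h b
      by_cases a : C ω = c <;> simp [ind, a, b, e1, e2]
    · by_cases a : C' ω = c <;> simp [ind, a, b, this]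

theorem stmt_6 {Ω : Type*} [MeasurableSpace Ω] (P : Measure Ω) [IsProbabilityMeasure P]
    {β γ : Type*}
    (Y₁ Y₁' Y₂ Y₂' : Ω → ℝ) (C₁ C₁' C₂ C₂' : Ω → β) (S₁ S₂ : Ω → γ)
    (c : β) (s₁ s₂ : γ)
    (hY₁m : Measurable Y₁) (hY₁'m : Measurable Y₁')
    (hY₂m : Measurable Y₂) (hY₂'m : Measurable Y₂')
    (hY₁01 : ∀ ω, 0 ≤ Y₁ ω ∧ Y₁ ω ≤ 1) (hY₁'01 : ∀ ω, 0 ≤ Y₁' ω ∧ Y₁' ω ≤ 1)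
    (hY₂01 : ∀ ω, 0 ≤ Y₂ ω ∧ Y₂ ω ≤ 1) (hY₂'01 : ∀ ω, 0 ≤ Y₂' ω ∧ Y₂' ω ≤ 1)
    (hC₁ : MeasurableSet {ω | C₁ ω = c}) (hC₁' : MeasurableSet {ω | C₁' ω = c})
    (hC₂ : MeasurableSet {ω | C₂ ω = c}) (hC₂' : MeasurableSet {ω | C₂' ω = c})
    (hS₁ : MeasurableSet {ω | S₁ ω = s₁}) (hS₂ : MeasurableSet {ω | S₂ ω = s₂})
    (hcons₁ : ∀ᵐ ω ∂P, S₁ ω = s₁ → Y₁' ω = Y₁ ω ∧ C₁' ω = C₁ ω)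
    (hcons₂ : ∀ᵐ ω ∂P, S₂ ω = s₂ → Y₂' ω = Y₂ ω ∧ C₂' ω = C₂ ω)
    (hpos₁ : 0 < (P {ω | C₁' ω = c}).toReal)
    (hpos₂ : 0 < (P {ω | C₂' ω = c}).toReal)
    (hgap :
      (∫ ω, Y₁ ω * ind {ω' | C₁ ω' = c} ω * ind {ω' | S₁ ω' = s₁} ω ∂P)
          / ((P {ω | C₁ ω = c ∧ S₁ ω = s₁}).toReal + 1 - (P {ω | S₁ ω = s₁}).toReal)
        - ((∫ ω, Y₂ ω * ind {ω' | C₂ ω' = c} ω * ind {ω' | S₂ ω' = s₂} ω ∂P)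
              + 1 - (P {ω | S₂ ω = s₂}).toReal)
            / ((P {ω | C₂ ω = c ∧ S₂ ω = s₂}).toReal + 1 - (P {ω | S₂ ω = s₂}).toReal)
        > 0) :
    (∫ ω, Y₁' ω * ind {ω' | C₁' ω' = c} ω ∂P) / (P {ω | C₁' ω = c}).toReal
      > (∫ ω, Y₂' ω * ind {ω' | C₂' ω' = c} ω ∂P) / (P {ω | C₂' ω = c}).toReal := by
  obtain ⟨a1, a2, a3, a4, a5, a6⟩ := aux_ind P Y₁ Y₁' C₁ C₁' S₁ c s₁ hY₁m hY₁'m hY₁01 hY₁'01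
    hC₁ hC₁' hS₁ hcons₁ _ _ _ _ _ rfl rfl rfl rfl rfl
  obtain ⟨b1, b2, b3, b4, b5, b6⟩ := aux_ind P Y₂ Y₂' C₂ C₂' S₂ c s₂ hY₂m hY₂'m hY₂01 hY₂'01
    hC₂ hC₂' hS₂ hcons₂ _ _ _ _ _ rfl rfl rfl rfl rfl
  have lo := div_le_div₀ (a1.trans a3) a3 hpos₁ a5
  refine lt_of_lt_of_le (lt_of_le_of_lt ?_ (sub_pos.mp hgap)) lo
  rw [div_le_div_iff₀ hpos₂ (lt_of_lt_of_le hpos₂ b5)]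
  generalize (∫ ω, Y₂ ω * ind {ω' | C₂ ω' = c} ω * ind {ω' | S₂ ω' = s₂} ω ∂P) = A at *
  generalize (P {ω | C₂ ω = c ∧ S₂ ω = s₂}).toReal = B at *
  generalize (P {ω | S₂ ω = s₂}).toReal = q at *
  generalize (∫ ω, Y₂' ω * ind {ω' | C₂' ω' = c} ω ∂P) = N at *
  generalize (P {ω | C₂' ω = c}).toReal = D at *
  have k1 : N * (B + 1 - q) ≤ (A + D - B) * (B + 1 - q) :=
    mul_le_mul_of_nonneg_right (by linarith) (by linarith)
  nlinarith [mul_nonneg (sub_nonneg.2 b2) (sub_nonneg.2 b5)]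
end

section
/- Let (Ω, 𝒜, P) be a probability space. Let Y, Y^r : Ω → [0,1] and C, C^r, R, S, S^r be random variables with values r, s, c such that the events {C = c}, {C^r = c}, {R = r}, {S = s}, {S^r = s} are measurable. Assume counterfactual consistency on {R = r}: P-almost surely on {R = r}, Y^r = Y, C^r = C and S^r = S; assume P(C = c, R = r, S = s) > 0. Then both of the following hold: (i) E[Y^r·1_{C^r = c}·1_{S^r = s}] / ( P(C^r = c, S^r = s) + 1 − P(S^r = s) ) ≥ E[Y·1_{C = c}·1_{R = r}·1_{S = s}] / ( P(C = c, R = r, S = s) + 1 − P(R = r, S = s) ); and (ii) ( E[Y^r·1_{C^r = c}·1_{S^r = s}] + 1 − P(S^r = s) ) / ( P(C^r = c, S^r = s) + 1 − P(S^r = s) ) ≤ ( E[Y·1_{C = c}·1_{R = r}·1_{S = s}] + 1 − P(R = r, S = s) ) / ( P(C = c, R = r, S = s) + 1 − P(R = r, S = s) ). -/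
open MeasureTheory

theorem stmt_7 {Ω : Type*} [MeasurableSpace Ω] (P : Measure Ω) [IsProbabilityMeasure P]
    {β γ ρ : Type*}
    (Y Yr : Ω → ℝ) (C Cr : Ω → β) (R : Ω → ρ) (S Sr : Ω → γ)
    (c : β) (r : ρ) (s : γ)
    (hYm : Measurable Y) (hYrm : Measurable Yr)
    (hY01 : ∀ ω, 0 ≤ Y ω ∧ Y ω ≤ 1) (hYr01 : ∀ ω, 0 ≤ Yr ω ∧ Yr ω ≤ 1)
    (hC : MeasurableSet {ω | C ω = c}) (hCr : MeasurableSet {ω | Cr ω = c})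
    (hR : MeasurableSet {ω | R ω = r})
    (hS : MeasurableSet {ω | S ω = s}) (hSr : MeasurableSet {ω | Sr ω = s})
    (hcons : ∀ᵐ ω ∂P, R ω = r → Yr ω = Y ω ∧ Cr ω = C ω ∧ Sr ω = S ω)
    (hpos : 0 < (P {ω | C ω = c ∧ R ω = r ∧ S ω = s}).toReal) :
    ((∫ ω, Yr ω * ind {ω' | Cr ω' = c} ω * ind {ω' | Sr ω' = s} ω ∂P)
          / ((P {ω | Cr ω = c ∧ Sr ω = s}).toReal + 1 - (P {ω | Sr ω = s}).toReal)
        ≥ (∫ ω, Y ω * ind {ω' | C ω' = c} ω * ind {ω' | R ω' = r} ω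
              * ind {ω' | S ω' = s} ω ∂P)
            / ((P {ω | C ω = c ∧ R ω = r ∧ S ω = s}).toReal
                + 1 - (P {ω | R ω = r ∧ S ω = s}).toReal)) ∧
    (((∫ ω, Yr ω * ind {ω' | Cr ω' = c} ω * ind {ω' | Sr ω' = s} ω ∂P)
            + 1 - (P {ω | Sr ω = s}).toReal)
          / ((P {ω | Cr ω = c ∧ Sr ω = s}).toReal + 1 - (P {ω | Sr ω = s}).toReal)
        ≤ ((∫ ω, Y ω * ind {ω' | C ω' = c} ω * ind {ω' | R ω' = r} ω
              * ind {ω' | S ω' = s} ω ∂P)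
              + 1 - (P {ω | R ω = r ∧ S ω = s}).toReal)
            / ((P {ω | C ω = c ∧ R ω = r ∧ S ω = s}).toReal
                + 1 - (P {ω | R ω = r ∧ S ω = s}).toReal)) := by
  have hind : ∀ A : Set Ω, MeasurableSet A → Measurable (ind A) := fun A hA =>
    (measurable_const.indicator hA : Measurable (A.indicator fun _ => (1 : ℝ)))
  have hval : ∀ (A : Set Ω) (ω : Ω), (ω ∈ A ∧ ind A ω = 1) ∨ (ω ∉ A ∧ ind A ω = 0) := by
    intro A ω
    by_cases h : ω ∈ A
    · left; simp [ind, h]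
    · right; simp [ind, h]
  have hb : ∀ (A : Set Ω) (ω : Ω), 0 ≤ ind A ω ∧ ind A ω ≤ 1 := by
    intro A ω
    rcases hval A ω with h | h <;> rw [h.2] <;> norm_num
  have hP : ∀ A : Set Ω, MeasurableSet A → (P A).toReal = ∫ ω, ind A ω ∂P := by
    intro A hA
    have := integral_indicator_one (μ := P) hA
    exact this.symm
  have hint : ∀ f : Ω → ℝ, Measurable f → (∀ ω, 0 ≤ f ω ∧ f ω ≤ 1) → Integrable f P := by
    intro f hf h
    refine Integrable.of_bound hf.aestronglyMeasurable 1 (Filter.Eventually.of_forall fun ω => ?_)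
    rw [Real.norm_eq_abs, abs_le]
    constructor <;> linarith [h ω]
  have m1 : MeasurableSet {ω | C ω = c ∧ R ω = r ∧ S ω = s} := hC.inter (hR.inter hS)
  have m2 : MeasurableSet {ω | R ω = r ∧ S ω = s} := hR.inter hS
  have m3 : MeasurableSet {ω | Cr ω = c ∧ Sr ω = s} := hCr.inter hSr
  have hq1 : (P {ω | Sr ω = s}).toReal ≤ 1 := by
    have := measureReal_le_one (μ := P) (s := {ω | Sr ω = s})
    exact this
  rw [hP _ m1] at hpos
  rw [hP _ hSr] at hq1
  rw [hP _ m1, hP _ m2, hP _ m3, hP _ hSr]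
  have i1 := hint _ (hind _ m1) (hb _)
  have i2 := hint _ (hind _ m2) (hb _)
  have i3 := hint _ (hind _ m3) (hb _)
  have i4 := hint _ (hind _ hSr) (hb _)
  have hA : Integrable (fun ω => Yr ω * ind {ω' | Cr ω' = c} ω * ind {ω' | Sr ω' = s} ω) P := by
    refine hint _ ((hYrm.mul (hind _ hCr)).mul (hind _ hSr)) fun ω => ?_
    have := hYr01 ω
    rcases hval {ω' | Cr ω' = c} ω with h | h <;> rcases hval {ω' | Sr ω' = s} ω with h' | h' <;>
      rw [h.2, h'.2] <;> constructor <;> linarith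
  have ha : Integrable (fun ω => Y ω * ind {ω' | C ω' = c} ω * ind {ω' | R ω' = r} ω
              * ind {ω' | S ω' = s} ω) P := by
    refine hint _ (((hYm.mul (hind _ hC)).mul (hind _ hR)).mul (hind _ hS)) fun ω => ?_
    have := hY01 ω
    rcases hval {ω' | C ω' = c} ω with h | h <;> rcases hval {ω' | S ω' = s} ω with h' | h' <;>
      rcases hval {ω' | R ω' = r} ω with h'' | h'' <;>
      rw [h.2, h'.2, h''.2] <;> constructor <;> linarith
  -- pointwise facts
  have key : ∀ᵐ ω ∂P,
      0 ≤ Y ω * ind {ω' | C ω' = c} ω * ind {ω' | R ω' = r} ω * ind {ω' | S ω' = s} ω ∧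
      Y ω * ind {ω' | C ω' = c} ω * ind {ω' | R ω' = r} ω * ind {ω' | S ω' = s} ω
        ≤ Yr ω * ind {ω' | Cr ω' = c} ω * ind {ω' | Sr ω' = s} ω ∧
      Y ω * ind {ω' | C ω' = c} ω * ind {ω' | R ω' = r} ω * ind {ω' | S ω' = s} ω
        ≤ ind {ω | C ω = c ∧ R ω = r ∧ S ω = s} ω ∧
      ind {ω | C ω = c ∧ R ω = r ∧ S ω = s} ω
        + Yr ω * ind {ω' | Cr ω' = c} ω * ind {ω' | Sr ω' = s} ω
        ≤ ind {ω | Cr ω = c ∧ Sr ω = s} ω +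
          Y ω * ind {ω' | C ω' = c} ω * ind {ω' | R ω' = r} ω * ind {ω' | S ω' = s} ω ∧
      ind {ω | C ω = c ∧ R ω = r ∧ S ω = s} ω ≤ ind {ω | Cr ω = c ∧ Sr ω = s} ω ∧
      ind {ω | Cr ω = c ∧ Sr ω = s} ω + ind {ω | R ω = r ∧ S ω = s} ω
        ≤ ind {ω | Sr ω = s} ω + ind {ω | C ω = c ∧ R ω = r ∧ S ω = s} ω := by
    filter_upwards [hcons] with ω h
    obtain ⟨y0, y1⟩ := hY01 ω
    obtain ⟨z0, z1⟩ := hYr01 ω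
    by_cases hr : R ω = r
    · obtain ⟨e1, e2, e3⟩ := h hr
      by_cases hc : C ω = c <;> by_cases hs : S ω = s <;>
        simp [ind, Set.indicator_apply, hr, e1, e2, e3, hc, hs, y0, y1]
    · by_cases hc : Cr ω = c <;> by_cases hs : Sr ω = s <;>
        simp [ind, Set.indicator_apply, hr, hc, hs, z0, z1]
  have k1 := integral_nonneg_of_ae (key.mono fun ω h => h.1)
  have k2 := integral_mono_ae ha hA (key.mono fun ω h => h.2.1)
  have k3 := integral_mono_ae ha i1 (key.mono fun ω h => h.2.2.1)
  have k4 := integral_mono_ae (i1.add hA) (i3.add ha) (key.mono fun ω h => h.2.2.2.1)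
  have k5 := integral_mono_ae i1 i3 (key.mono fun ω h => h.2.2.2.2.1)
  have k6 := integral_mono_ae (i3.add i2) (i4.add i1) (key.mono fun ω h => h.2.2.2.2.2)
  rw [integral_add' i1 hA, integral_add' i3 ha] at k4
  rw [integral_add' i3 i2, integral_add' i4 i1] at k6
  generalize (∫ ω, Yr ω * ind {ω' | Cr ω' = c} ω * ind {ω' | Sr ω' = s} ω ∂P) = A at *
  generalize (∫ ω, Y ω * ind {ω' | C ω' = c} ω * ind {ω' | R ω' = r} ω
              * ind {ω' | S ω' = s} ω ∂P) = a at *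
  generalize (∫ ω, ind {ω | C ω = c ∧ R ω = r ∧ S ω = s} ω ∂P) = p' at *
  generalize (∫ ω, ind {ω | R ω = r ∧ S ω = s} ω ∂P) = q' at *
  generalize (∫ ω, ind {ω | Cr ω = c ∧ Sr ω = s} ω ∂P) = p at *
  generalize (∫ ω, ind {ω | Sr ω = s} ω ∂P) = q at *
  have d1 : 0 < p + 1 - q := by linarith
  have d2 : 0 < p' + 1 - q' := by linarith
  constructor
  · exact div_le_div₀ (by linarith) k2 d1 (by linarith)
  · have e1 : (A + 1 - q) / (p + 1 - q) = 1 - (p - A) / (p + 1 - q) := by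
      field_simp; ring
    have e2 : (a + 1 - q') / (p' + 1 - q') = 1 - (p' - a) / (p' + 1 - q') := by
      field_simp; ring
    have := div_le_div₀ (a := p' - a) (b := p' + 1 - q') (c := p - A) (d := p + 1 - q)
      (by linarith) (by linarith) d1 (by linarith)
    rw [e1, e2]
    linarith
end

section
/- Let (Ω, 𝒜, P) be a probability space, Y, Y′₁, Y′₀ : Ω → [0,1] random variables, and Z, C random variables with values z₁, z₀, c such that the events {Z = z₁}, {Z = z₀}, {C = c} are measurable. Assume counterfactual consistency: P-almost surely on {Z = z₁, C = c}, Y′₁ = Y; and P-almost surely on {Z = z₀, C = c}, Y′₀ = Y. Define the direct discrimination gap Ψ := E[Y′₁] − E[Y′₀]. Then E[Y·1_{Z = z₁}·1_{C = c}] − E[Y·1_{Z = z₀}·1_{C = c}] + P(Z = z₀, C = c) − 1 ≤ Ψ ≤ E[Y·1_{Z = z₁}·1_{C = c}] − E[Y·1_{Z = z₀}·1_{C = c}] + 1 − P(Z = z₁, C = c). -/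
open MeasureTheory

theorem aux_bound {Ω : Type*} [MeasurableSpace Ω] (P : Measure Ω) [IsProbabilityMeasure P]
    {β γ : Type*} (Y Y' : Ω → ℝ) (Z : Ω → γ) (C : Ω → β) (z : γ) (c : β)
    (hYm : Measurable Y) (hYm' : Measurable Y')
    (hY01 : ∀ ω, 0 ≤ Y ω ∧ Y ω ≤ 1) (hY01' : ∀ ω, 0 ≤ Y' ω ∧ Y' ω ≤ 1)
    (hZ : MeasurableSet {ω | Z ω = z}) (hC : MeasurableSet {ω | C ω = c})
    (hcons : ∀ᵐ ω ∂P, Z ω = z ∧ C ω = c → Y' ω = Y ω) :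
    (∫ ω, Y ω * ind {ω' | Z ω' = z} ω * ind {ω' | C ω' = c} ω ∂P) ≤ ∫ ω, Y' ω ∂P ∧
    (∫ ω, Y' ω ∂P) ≤ (∫ ω, Y ω * ind {ω' | Z ω' = z} ω * ind {ω' | C ω' = c} ω ∂P)
      + 1 - (P {ω | Z ω = z ∧ C ω = c}).toReal := by
  have hS : MeasurableSet {ω | Z ω = z ∧ C ω = c} := hZ.inter hC
  have e : (fun ω => Y ω * ind {ω' | Z ω' = z} ω * ind {ω' | C ω' = c} ω)
      = {ω | Z ω = z ∧ C ω = c}.indicator Y := by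
    funext ω
    by_cases h1 : Z ω = z <;> by_cases h2 : C ω = c <;> simp [ind, Set.indicator, h1, h2]
  have iY : Integrable Y P := Integrable.of_bound hYm.aestronglyMeasurable 1
    (Filter.Eventually.of_forall fun ω => by
      rw [Real.norm_eq_abs, abs_le]; constructor <;> linarith [(hY01 ω).1, (hY01 ω).2])
  have iY' : Integrable Y' P := Integrable.of_bound hYm'.aestronglyMeasurable 1
    (Filter.Eventually.of_forall fun ω => by
      rw [Real.norm_eq_abs, abs_le]; constructor <;> linarith [(hY01' ω).1, (hY01' ω).2])
  have iA := iY.indicator hS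
  rw [e]
  constructor
  · refine integral_mono_ae iA iY' ?_
    filter_upwards [hcons] with ω h
    by_cases hω : Z ω = z ∧ C ω = c
    · simp [Set.indicator, hω, h hω]
    · simpa [Set.indicator, hω] using (hY01' ω).1
  · have i1 : Integrable (fun _ : Ω => (1 : ℝ)) P := integrable_const 1
    have iI := i1.indicator hS
    have hI : ∫ ω, {ω | Z ω = z ∧ C ω = c}.indicator (fun _ => (1 : ℝ)) ω ∂P
        = (P {ω | Z ω = z ∧ C ω = c}).toReal := by
      rw [integral_indicator hS]; simp [Measure.real]
    have h1 : ∫ _ : Ω, (1 : ℝ) ∂P = 1 := by simp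
    have key : (∫ ω, Y' ω + {ω | Z ω = z ∧ C ω = c}.indicator (fun _ => (1 : ℝ)) ω ∂P)
        ≤ ∫ ω, {ω | Z ω = z ∧ C ω = c}.indicator Y ω + 1 ∂P := by
      refine integral_mono_ae (iY'.add iI) (iA.add i1) ?_
      filter_upwards [hcons] with ω h
      by_cases hω : Z ω = z ∧ C ω = c
      · simp [Set.indicator, hω, h hω]
      · simpa [Set.indicator, hω] using (hY01' ω).2
    rw [integral_add iY' iI, integral_add iA i1, hI, h1] at key
    linarith

theorem stmt_12 {Ω : Type*} [MeasurableSpace Ω] (P : Measure Ω) [IsProbabilityMeasure P]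
    {β γ : Type*} (Y Y'₁ Y'₀ : Ω → ℝ) (Z : Ω → γ) (C : Ω → β) (z₁ z₀ : γ) (c : β)
    (hYm : Measurable Y) (hY'₁m : Measurable Y'₁) (hY'₀m : Measurable Y'₀)
    (hY01 : ∀ ω, 0 ≤ Y ω ∧ Y ω ≤ 1)
    (hY'₁01 : ∀ ω, 0 ≤ Y'₁ ω ∧ Y'₁ ω ≤ 1) (hY'₀01 : ∀ ω, 0 ≤ Y'₀ ω ∧ Y'₀ ω ≤ 1)
    (hZ₁ : MeasurableSet {ω | Z ω = z₁}) (hZ₀ : MeasurableSet {ω | Z ω = z₀})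
    (hC : MeasurableSet {ω | C ω = c})
    (hcons₁ : ∀ᵐ ω ∂P, Z ω = z₁ ∧ C ω = c → Y'₁ ω = Y ω)
    (hcons₀ : ∀ᵐ ω ∂P, Z ω = z₀ ∧ C ω = c → Y'₀ ω = Y ω) :
    (∫ ω, Y ω * ind {ω' | Z ω' = z₁} ω * ind {ω' | C ω' = c} ω ∂P)
        - (∫ ω, Y ω * ind {ω' | Z ω' = z₀} ω * ind {ω' | C ω' = c} ω ∂P)
        + (P {ω | Z ω = z₀ ∧ C ω = c}).toReal - 1
      ≤ (∫ ω, Y'₁ ω ∂P) - (∫ ω, Y'₀ ω ∂P) ∧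
    (∫ ω, Y'₁ ω ∂P) - (∫ ω, Y'₀ ω ∂P)
      ≤ (∫ ω, Y ω * ind {ω' | Z ω' = z₁} ω * ind {ω' | C ω' = c} ω ∂P)
          - (∫ ω, Y ω * ind {ω' | Z ω' = z₀} ω * ind {ω' | C ω' = c} ω ∂P)
          + 1 - (P {ω | Z ω = z₁ ∧ C ω = c}).toReal := by
  obtain ⟨a, b⟩ := aux_bound P Y Y'₁ Z C z₁ c hYm hY'₁m hY01 hY'₁01 hZ₁ hC hcons₁
  obtain ⟨a', b'⟩ := aux_bound P Y Y'₀ Z C z₀ c hYm hY'₀m hY01 hY'₀01 hZ₀ hC hcons₀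
  constructor <;> linarith
end

section
/- Let (Ω, 𝒜, P) be a probability space, Y, Y′ : Ω → {0, 1} random variables, and D a random variable taking, P-almost surely, only the two distinct values d₀ and d₁. Assume: (a) counterfactual consistency on {D = d₁}: P-almost surely on {D = d₁}, Y′ = Y; (b) Y′ is independent of D; (c) P(Y = 0, D = d₀) > 0. Then P(Y′ = 1) − P(Y = 1) ≤ P(Y′ = 1, Y = 0, D = d₀) ≤ P(Y′ = 1)·(1 − P(D = d₁)); equivalently, the causal harm gap Ω_c := P(Y′ = 1 | Y = 0, D = d₀) satisfies ( P(Y′ = 1) − P(Y = 1) ) / P(Y = 0, D = d₀) ≤ Ω_c ≤ P(Y′ = 1)·(1 − P(D = d₁)) / P(Y = 0, D = d₀). -/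
open MeasureTheory ProbabilityTheory

theorem stmt_13 {Ω : Type*} [MeasurableSpace Ω] (P : Measure Ω) [IsProbabilityMeasure P]
    {δ : Type*} [MeasurableSpace δ] (Y Y' : Ω → ℝ) (D : Ω → δ) (d₀ d₁ : δ)
    (hd : d₀ ≠ d₁)
    (hYm : Measurable Y) (hY'm : Measurable Y') (hDm : Measurable D)
    (hYbin : ∀ ω, Y ω = 0 ∨ Y ω = 1) (hY'bin : ∀ ω, Y' ω = 0 ∨ Y' ω = 1)
    (hDbin : ∀ᵐ ω ∂P, D ω = d₀ ∨ D ω = d₁)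
    (hd₀ : MeasurableSet ({d₀} : Set δ)) (hd₁ : MeasurableSet ({d₁} : Set δ))
    -- (a) counterfactual consistency on {D = d₁}
    (hcons : ∀ᵐ ω ∂P, D ω = d₁ → Y' ω = Y ω)
    -- (b) Y' is independent of D
    (hindep : IndepFun Y' D P)
    -- (c) positivity
    (hpos : 0 < (P {ω | Y ω = 0 ∧ D ω = d₀}).toReal) :
    ((P {ω | Y' ω = 1}).toReal - (P {ω | Y ω = 1}).toReal
        ≤ (P {ω | Y' ω = 1 ∧ Y ω = 0 ∧ D ω = d₀}).toReal ∧
      (P {ω | Y' ω = 1 ∧ Y ω = 0 ∧ D ω = d₀}).toReal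
        ≤ (P {ω | Y' ω = 1}).toReal * (1 - (P {ω | D ω = d₁}).toReal)) ∧
    (((P {ω | Y' ω = 1}).toReal - (P {ω | Y ω = 1}).toReal)
          / (P {ω | Y ω = 0 ∧ D ω = d₀}).toReal
        ≤ (P {ω | Y' ω = 1 ∧ Y ω = 0 ∧ D ω = d₀}).toReal
            / (P {ω | Y ω = 0 ∧ D ω = d₀}).toReal ∧
      (P {ω | Y' ω = 1 ∧ Y ω = 0 ∧ D ω = d₀}).toReal
            / (P {ω | Y ω = 0 ∧ D ω = d₀}).toReal
        ≤ (P {ω | Y' ω = 1}).toReal * (1 - (P {ω | D ω = d₁}).toReal)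
            / (P {ω | Y ω = 0 ∧ D ω = d₀}).toReal) := by
  have h1 : (P {ω | Y' ω = 1}).toReal - (P {ω | Y ω = 1}).toReal
        ≤ (P {ω | Y' ω = 1 ∧ Y ω = 0 ∧ D ω = d₀}).toReal := by
    have hle : P {ω | Y' ω = 1}
        ≤ P ({ω | Y ω = 1} ∪ {ω | Y' ω = 1 ∧ Y ω = 0 ∧ D ω = d₀}) := by
      apply measure_mono_ae
      filter_upwards [hDbin, hcons] with ω hD hc h
      change Y' ω = 1 at h
      change Y ω = 1 ∨ (Y' ω = 1 ∧ Y ω = 0 ∧ D ω = d₀)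
      rcases hYbin ω with h0 | h0
      · rcases hD with hD | hD
        · exact Or.inr ⟨h, h0, hD⟩
        · exact Or.inl ((hc hD).symm.trans h)
      · exact Or.inl h0
    have h2 := hle.trans (measure_union_le _ _)
    have h3 := ENNReal.toReal_mono (by finiteness) h2
    rw [ENNReal.toReal_add (by finiteness) (by finiteness)] at h3
    linarith
  have h2 : (P {ω | Y' ω = 1 ∧ Y ω = 0 ∧ D ω = d₀}).toReal
        ≤ (P {ω | Y' ω = 1}).toReal * (1 - (P {ω | D ω = d₁}).toReal) := by
    have hi := hindep.measure_inter_preimage_eq_mul {1} {d₁}ᶜ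
      (measurableSet_singleton _) hd₁.compl
    have hc : (P (D ⁻¹' {d₁}ᶜ)).toReal = 1 - (P {ω | D ω = d₁}).toReal :=
      probReal_compl_eq_one_sub (μ := P) (hDm hd₁)
    have hle : P {ω | Y' ω = 1 ∧ Y ω = 0 ∧ D ω = d₀}
        ≤ P (Y' ⁻¹' {1} ∩ D ⁻¹' {d₁}ᶜ) := by
      apply measure_mono
      rintro ω ⟨h, -, hD⟩
      exact ⟨h, fun h' => hd (hD.symm.trans h')⟩
    rw [hi] at hle
    have h3 := ENNReal.toReal_mono (by finiteness) hle
    rw [ENNReal.toReal_mul, hc] at h3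
    exact h3
  exact ⟨⟨h1, h2⟩, div_le_div_of_nonneg_right h1 hpos.le,
    div_le_div_of_nonneg_right h2 hpos.le⟩
end

section
/- Define the canonical response map y : {0,1,2,3} × {0,1} → {0,1} by y(0, z) = 0, y(1, z) = z, y(2, z) = 1 − z, y(3, z) = 1. Then for every probability mass function p on {0,1} × {0,1} the following two existence claims hold. (Lower): there exist probability mass functions μ⁻ and ν⁻ on {0,1} × {0,1,2,3} such that (a) μ⁻ induces p, i.e. for all (a, b) ∈ {0,1}², Σ_{r_y : y(r_y, a) = b} μ⁻(a, r_y) = p(a, b); (b) ν⁻ has the same marginal over the second coordinate as μ⁻, i.e. for all r_y, Σ_{r_z} ν⁻(r_z, r_y) = Σ_{r_z} μ⁻(r_z, r_y); and (c) Σ_{(r_z, r_y) : y(r_y, r_z) = 1} ν⁻(r_z, r_y) = 0. (Upper): there exist probability mass functions μ⁺ and ν⁺ on {0,1} × {0,1,2,3} satisfying (a) and (b) with μ⁺, ν⁺ in place of μ⁻, ν⁻, and such that Σ_{(r_z, r_y) : y(r_y, r_z) = 1} ν⁺(r_z, r_y) = 1. -/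
/-- The canonical response map: `ycan 0 z = 0`, `ycan 1 z = z`,
`ycan 2 z = 1 - z`, `ycan 3 z = 1`. -/
def ycan (r : Fin 4) (z : Fin 2) : Fin 2 :=
  if r = 0 then 0 else if r = 1 then z else if r = 2 then 1 - z else 1

theorem stmt_14 (p : Fin 2 × Fin 2 → ℝ)
    (hp0 : ∀ q, 0 ≤ p q) (hp1 : ∑ q, p q = 1) :
    (∃ μ ν : Fin 2 × Fin 4 → ℝ,
      (∀ q, 0 ≤ μ q) ∧ (∑ q, μ q = 1) ∧ (∀ q, 0 ≤ ν q) ∧ (∑ q, ν q = 1) ∧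
      (∀ a b : Fin 2,
        ∑ ry ∈ Finset.univ.filter (fun ry => ycan ry a = b), μ (a, ry) = p (a, b)) ∧
      (∀ ry : Fin 4, ∑ rz : Fin 2, ν (rz, ry) = ∑ rz : Fin 2, μ (rz, ry)) ∧
      (∑ q ∈ Finset.univ.filter (fun q : Fin 2 × Fin 4 => ycan q.2 q.1 = 1), ν q = 0)) ∧
    (∃ μ ν : Fin 2 × Fin 4 → ℝ,
      (∀ q, 0 ≤ μ q) ∧ (∑ q, μ q = 1) ∧ (∀ q, 0 ≤ ν q) ∧ (∑ q, ν q = 1) ∧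
      (∀ a b : Fin 2,
        ∑ ry ∈ Finset.univ.filter (fun ry => ycan ry a = b), μ (a, ry) = p (a, b)) ∧
      (∀ ry : Fin 4, ∑ rz : Fin 2, ν (rz, ry) = ∑ rz : Fin 2, μ (rz, ry)) ∧
      (∑ q ∈ Finset.univ.filter (fun q : Fin 2 × Fin 4 => ycan q.2 q.1 = 1), ν q = 1)) := by
  have h : p (0,0) + p (0,1) + (p (1,0) + p (1,1)) = 1 := by
    simpa [Fintype.sum_prod_type, Fin.sum_univ_two] using hp1
  have h00 := hp0 (0,0)
  have h01 := hp0 (0,1)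
  have h10 := hp0 (1,0)
  have h11 := hp0 (1,1)
  refine ⟨⟨fun q => ![![0, p (0,0), p (0,1), 0], ![0, p (1,1), p (1,0), 0]] q.1 q.2,
    fun q => ![![0, p (0,0) + p (1,1), 0, 0], ![0, 0, p (0,1) + p (1,0), 0]] q.1 q.2,
    ?_, ?_, ?_, ?_, ?_, ?_, ?_⟩,
    ⟨fun q => ![![0, p (0,0), p (0,1), 0], ![0, p (1,1), p (1,0), 0]] q.1 q.2,
    fun q => ![![0, 0, p (0,1) + p (1,0), 0], ![0, p (0,0) + p (1,1), 0, 0]] q.1 q.2,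
    ?_, ?_, ?_, ?_, ?_, ?_, ?_⟩⟩
  all_goals first
    | (rintro ⟨a, b⟩
       fin_cases a <;> fin_cases b <;> simp <;> linarith)
    | (simp [Fintype.sum_prod_type, Fin.sum_univ_succ]; linarith)
    | (intro a b
       fin_cases a <;> fin_cases b <;>
         simp [Finset.sum_filter, Fin.sum_univ_succ, ycan])
    | (intro a
       fin_cases a <;> simp [Fin.sum_univ_succ] <;> ring)
    | (rw [Finset.sum_filter, Fintype.sum_prod_type]; simp [Fin.sum_univ_succ, ycan]; done)
    | (rw [Finset.sum_filter, Fintype.sum_prod_type]; simp [Fin.sum_univ_succ, ycan]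
       linarith)
end

section
/- Let (Ω, 𝒜, P) be a probability space and α ∈ [0, 1]. For each label e ∈ {1, 2} (two decisions), let Y*_e, Y*′_e, Y_e : Ω → {0, 1} be random variables and Z_e a random variable with {Z_e = z} measurable, such that P-almost surely on {Z_e = z}, Y*′_e = Y*_e (counterfactual consistency). Assume the proxy-alignment condition for decision 1: P(Y*_1 = 1, Y_1 = 1, Z_1 = z) ≥ α · P(Y_1 = 1, Z_1 = z). Then P(Y*′_1 = 1) − P(Y*′_2 = 1) ≥ α · P(Y_1 = 1, Z_1 = z) − 1. -/
open MeasureTheory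

theorem stmt_15 {Ω : Type*} [MeasurableSpace Ω] (P : Measure Ω) [IsProbabilityMeasure P]
    {γ : Type*} (α : ℝ) (hα : α ∈ Set.Icc (0 : ℝ) 1)
    (Ys₁ Ys₁' Y₁ Ys₂ Ys₂' Y₂ : Ω → ℝ) (Z₁ Z₂ : Ω → γ) (z : γ)
    (hYs₁m : Measurable Ys₁) (hYs₁'m : Measurable Ys₁') (hY₁m : Measurable Y₁)
    (hYs₂m : Measurable Ys₂) (hYs₂'m : Measurable Ys₂') (hY₂m : Measurable Y₂)
    (hYs₁bin : ∀ ω, Ys₁ ω = 0 ∨ Ys₁ ω = 1) (hYs₁'bin : ∀ ω, Ys₁' ω = 0 ∨ Ys₁' ω = 1)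
    (hY₁bin : ∀ ω, Y₁ ω = 0 ∨ Y₁ ω = 1)
    (hYs₂bin : ∀ ω, Ys₂ ω = 0 ∨ Ys₂ ω = 1) (hYs₂'bin : ∀ ω, Ys₂' ω = 0 ∨ Ys₂' ω = 1)
    (hY₂bin : ∀ ω, Y₂ ω = 0 ∨ Y₂ ω = 1)
    (hZ₁ : MeasurableSet {ω | Z₁ ω = z}) (hZ₂ : MeasurableSet {ω | Z₂ ω = z})
    (hcons₁ : ∀ᵐ ω ∂P, Z₁ ω = z → Ys₁' ω = Ys₁ ω)
    (hcons₂ : ∀ᵐ ω ∂P, Z₂ ω = z → Ys₂' ω = Ys₂ ω)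
    (hproxy : (P {ω | Ys₁ ω = 1 ∧ Y₁ ω = 1 ∧ Z₁ ω = z}).toReal
        ≥ α * (P {ω | Y₁ ω = 1 ∧ Z₁ ω = z}).toReal) :
    (P {ω | Ys₁' ω = 1}).toReal - (P {ω | Ys₂' ω = 1}).toReal
      ≥ α * (P {ω | Y₁ ω = 1 ∧ Z₁ ω = z}).toReal - 1 := by
  have h1 : P {ω | Ys₁ ω = 1 ∧ Y₁ ω = 1 ∧ Z₁ ω = z} ≤ P {ω | Ys₁' ω = 1} := by
    apply measure_mono_ae
    filter_upwards [hcons₁] with ω hω h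
    obtain ⟨ha, _, hc⟩ := h
    exact (hω hc).trans ha
  have h2 := ENNReal.toReal_mono (measure_ne_top P _) h1
  have h3 : (P {ω | Ys₂' ω = 1}).toReal ≤ 1 :=
    ENNReal.toReal_mono ENNReal.one_ne_top prob_le_one
  linarith
end

section
/- Let (Ω, 𝒜, P) be a probability space, Y, Y′ : Ω → [0,1] random variables, Z a random variable with {Z = z} measurable, and W, W′ random variables taking, P-almost surely, only the two distinct values w and w̃. Assume: (a) counterfactual consistency on {Z = z}: P-almost surely on {Z = z}, Y′ = Y and W′ = W; (b) positivity: P(W = w, Z = z) > 0, P(W = w̃, Z = z) > 0, P(W′ = w) > 0, P(W′ = w̃) > 0; (c) conditional unconfoundedness: for each v ∈ {w, w̃}, E[Y′·1_{W′ = v}] / P(W′ = v) = E[Y·1_{W = v}·1_{Z = z}] / P(W = v, Z = z); (d) the ordering E[Y·1_{W = w}·1_{Z = z}] / P(W = w, Z = z) ≥ E[Y·1_{W = w̃}·1_{Z = z}] / P(W = w̃, Z = z). Write m_v := E[Y·1_{W = v}·1_{Z = z}] / P(W = v, Z = z). Then (m_w − m_{w̃})·P(W = w, Z = z) + m_{w̃}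 ≤ E[Y′] ≤ (m_w − m_{w̃})·( P(W = w, Z = z) + 1 − P(Z = z) ) + m_{w̃}. -/
open MeasureTheory

theorem stmt_16 {Ω : Type*} [MeasurableSpace Ω] (P : Measure Ω) [IsProbabilityMeasure P]
    {γ τ : Type*} (Y Y' : Ω → ℝ) (Z : Ω → γ) (W W' : Ω → τ) (z : γ) (w wt : τ)
    (hw : w ≠ wt)
    (hYm : Measurable Y) (hY'm : Measurable Y')
    (hY01 : ∀ ω, 0 ≤ Y ω ∧ Y ω ≤ 1) (hY'01 : ∀ ω, 0 ≤ Y' ω ∧ Y' ω ≤ 1)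
    (hZ : MeasurableSet {ω | Z ω = z})
    (hWw : MeasurableSet {ω | W ω = w}) (hWwt : MeasurableSet {ω | W ω = wt})
    (hW'w : MeasurableSet {ω | W' ω = w}) (hW'wt : MeasurableSet {ω | W' ω = wt})
    (hWbin : ∀ᵐ ω ∂P, W ω = w ∨ W ω = wt)
    (hW'bin : ∀ᵐ ω ∂P, W' ω = w ∨ W' ω = wt)
    -- (a) counterfactual consistency on {Z = z}
    (hcons : ∀ᵐ ω ∂P, Z ω = z → Y' ω = Y ω ∧ W' ω = W ω)
    -- (b) positivity
    (hposw : 0 < (P {ω | W ω = w ∧ Z ω = z}).toReal)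
    (hposwt : 0 < (P {ω | W ω = wt ∧ Z ω = z}).toReal)
    (hpos'w : 0 < (P {ω | W' ω = w}).toReal)
    (hpos'wt : 0 < (P {ω | W' ω = wt}).toReal)
    -- (c) conditional unconfoundedness
    (huncw : (∫ ω, Y' ω * ind {ω' | W' ω' = w} ω ∂P) / (P {ω | W' ω = w}).toReal
        = (∫ ω, Y ω * ind {ω' | W ω' = w} ω * ind {ω' | Z ω' = z} ω ∂P)
            / (P {ω | W ω = w ∧ Z ω = z}).toReal)
    (huncwt : (∫ ω, Y' ω * ind {ω' | W' ω' = wt} ω ∂P) / (P {ω | W' ω = wt}).toReal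
        = (∫ ω, Y ω * ind {ω' | W ω' = wt} ω * ind {ω' | Z ω' = z} ω ∂P)
            / (P {ω | W ω = wt ∧ Z ω = z}).toReal)
    -- (d) ordering of the conditional means
    (hord : (∫ ω, Y ω * ind {ω' | W ω' = w} ω * ind {ω' | Z ω' = z} ω ∂P)
            / (P {ω | W ω = w ∧ Z ω = z}).toReal
        ≥ (∫ ω, Y ω * ind {ω' | W ω' = wt} ω * ind {ω' | Z ω' = z} ω ∂P)
            / (P {ω | W ω = wt ∧ Z ω = z}).toReal) :
    ((∫ ω, Y ω * ind {ω' | W ω' = w} ω * ind {ω' | Z ω' = z} ω ∂P)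
            / (P {ω | W ω = w ∧ Z ω = z}).toReal
          - (∫ ω, Y ω * ind {ω' | W ω' = wt} ω * ind {ω' | Z ω' = z} ω ∂P)
            / (P {ω | W ω = wt ∧ Z ω = z}).toReal)
        * (P {ω | W ω = w ∧ Z ω = z}).toReal
      + (∫ ω, Y ω * ind {ω' | W ω' = wt} ω * ind {ω' | Z ω' = z} ω ∂P)
          / (P {ω | W ω = wt ∧ Z ω = z}).toReal
      ≤ ∫ ω, Y' ω ∂P ∧
    ∫ ω, Y' ω ∂P
      ≤ ((∫ ω, Y ω * ind {ω' | W ω' = w} ω * ind {ω' | Z ω' = z} ω ∂P)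
              / (P {ω | W ω = w ∧ Z ω = z}).toReal
            - (∫ ω, Y ω * ind {ω' | W ω' = wt} ω * ind {ω' | Z ω' = z} ω ∂P)
              / (P {ω | W ω = wt ∧ Z ω = z}).toReal)
          * ((P {ω | W ω = w ∧ Z ω = z}).toReal + 1 - (P {ω | Z ω = z}).toReal)
        + (∫ ω, Y ω * ind {ω' | W ω' = wt} ω * ind {ω' | Z ω' = z} ω ∂P)
            / (P {ω | W ω = wt ∧ Z ω = z}).toReal := by
  have hqt : (P {ω | W' ω = wt}).toReal = 1 - (P {ω | W' ω = w}).toReal := by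
    have h1 : P {ω | W' ω = wt} = P {ω | W' ω = w}ᶜ := by
      apply measure_congr
      filter_upwards [hW'bin] with ω h
      apply propext
      change W' ω = wt ↔ ¬ (W' ω = w)
      constructor
      · intro h1 h2
        exact hw (h2.symm.trans h1)
      · intro h1
        exact h.resolve_left h1
    rw [h1]
    exact probReal_compl_eq_one_sub hW'w
  have hZc : (P {ω | Z ω = z}ᶜ).toReal = 1 - (P {ω | Z ω = z}).toReal :=
    probReal_compl_eq_one_sub hZ
  have hlo : (P {ω | W ω = w ∧ Z ω = z}).toReal ≤ (P {ω | W' ω = w}).toReal := by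
    apply ENNReal.toReal_mono (measure_ne_top _ _)
    apply measure_mono_ae
    filter_upwards [hcons] with ω h
    intro h1
    exact (h h1.2).2.trans h1.1
  have hhi : (P {ω | W' ω = w}).toReal
      ≤ (P {ω | W ω = w ∧ Z ω = z}).toReal + (P {ω | Z ω = z}ᶜ).toReal := by
    rw [← ENNReal.toReal_add (measure_ne_top _ _) (measure_ne_top _ _)]
    apply ENNReal.toReal_mono (by finiteness)
    refine le_trans ?_ (measure_union_le _ _)
    apply measure_mono_ae
    filter_upwards [hcons] with ω h
    intro h1
    by_cases hz : Z ω = z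
    · exact Or.inl ⟨(h hz).2.symm.trans h1, hz⟩
    · exact Or.inr hz
  have hint : Integrable Y' P := by
    refine Integrable.of_bound hY'm.aestronglyMeasurable 1 (Filter.Eventually.of_forall ?_)
    intro ω
    rw [Real.norm_eq_abs, abs_of_nonneg (hY'01 ω).1]
    exact (hY'01 ω).2
  have hi : ∀ s : Set Ω, MeasurableSet s → Integrable (fun ω => Y' ω * ind s ω) P := by
    intro s hs
    refine (hint.indicator hs).congr (Filter.Eventually.of_forall ?_)
    intro ω
    by_cases h : ω ∈ s <;> simp [ind, h]
  have hsum : ∫ ω, Y' ω ∂P = (∫ ω, Y' ω * ind {ω' | W' ω' = w} ω ∂P)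
      + ∫ ω, Y' ω * ind {ω' | W' ω' = wt} ω ∂P := by
    rw [← integral_add (hi _ hW'w) (hi _ hW'wt)]
    apply integral_congr_ae
    filter_upwards [hW'bin] with ω h
    rcases h with h | h
    · simp [ind, h, hw]
    · simp [ind, h, hw.symm]
  rw [div_eq_iff hpos'w.ne'] at huncw
  rw [div_eq_iff hpos'wt.ne', hqt] at huncwt
  rw [hsum, huncw, huncwt]
  rw [hZc] at hhi
  have hd := sub_nonneg.2 hord
  constructor
  · linarith [mul_le_mul_of_nonneg_left hlo hd]
  · linarith [mul_le_mul_of_nonneg_left hhi hd]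
end
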